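/- (Lemma 5.3, convergence of the inclusion sets for the discrete Laplacian) Suppose ε ≥ 0. Then d_H(Spec_ε L_N, [−2,2] + ε·𝔻̄) → 0 as N → ∞. Moreover, if S_{n,N} denotes either Σ^n_ε(L_N) or Γ^n_ε(L_N), then d_H(S_{n,N}, [−2,2] + ε·𝔻̄) → 0 as n, N → ∞ with n < N, and consequently d_H(S_{n,N}, Spec_ε L_N) → 0 as n, N → ∞ with n < N. -/

import Mathlib

open scoped Real

noncomputable section

namespace SpecInclJL

/-- The smallest singular value of a (possibly rectangular) complex matrix,
as the infimum of `‖F x‖` over the unit sphere. -/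
noncomputable def sval {ι κ : Type*} [Fintype ι] [Fintype κ] [DecidableEq κ]
    (F : Matrix ι κ ℂ) : ℝ :=
  sInf {y : ℝ | ∃ x : EuclideanSpace ℂ κ, ‖x‖ = 1 ∧ y = ‖Matrix.toEuclideanLin F x‖}

/-- The closed ε-pseudospectrum of a square complex matrix. -/
noncomputable def pspec {ι : Type*} [Fintype ι] [DecidableEq ι] (ε : ℝ)
    (E : Matrix ι ι ℂ) : Set ℂ :=
  {z : ℂ | sval (E - z • (1 : Matrix ι ι ℂ)) ≤ ε}

/-- The n×n Jordan block `V_n` (zero diagonal, ones on the superdiagonal). -/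
def Vm (n : ℕ) : Matrix (Fin n) (Fin n) ℂ :=
  fun i j => if (i : ℕ) + 1 = (j : ℕ) then 1 else 0

/-- The periodised Jordan block `V^{per,t}_n`: `V_n` plus the entry `t̄` in
position (n,1) (1-based); `V^{per,t}_1 = t̄`. -/
def Vper (n : ℕ) (t : ℂ) : Matrix (Fin n) (Fin n) ℂ :=
  fun i j => (if (i : ℕ) + 1 = (j : ℕ) then 1 else 0)
    + (if (i : ℕ) = n - 1 ∧ (j : ℕ) = 0 then (starRingEnd ℂ) t else 0)

/-- The (n+2)×n matrix `V⁺_n`: first row `(1,0,…,0)`, middle n rows `V_n`,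
last row zero. -/
def VP (n : ℕ) : Matrix (Fin (n + 2)) (Fin n) ℂ :=
  fun i j => if ((i : ℕ) = 0 ∧ (j : ℕ) = 0) ∨
    (1 ≤ (i : ℕ) ∧ (i : ℕ) ≤ n ∧ (j : ℕ) = (i : ℕ)) then 1 else 0

/-- The (n+2)×n matrix `Ṽ⁺_n`: zero first and last rows, middle part `V_n`. -/
def VtP (n : ℕ) : Matrix (Fin (n + 2)) (Fin n) ℂ :=
  fun i j => if 1 ≤ (i : ℕ) ∧ (i : ℕ) ≤ n ∧ (j : ℕ) = (i : ℕ) then 1 else 0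

/-- The (n+2)×n matrix `I⁺_n`: middle part the identity, first and last rows
zero. -/
def IP (n : ℕ) : Matrix (Fin (n + 2)) (Fin n) ℂ :=
  fun i j => if (i : ℕ) = (j : ℕ) + 1 then 1 else 0

/-- The closed ε-pseudospectrum of an (n+2)×n matrix `E⁺`:
`{λ : s_min(E⁺ − λ I⁺_n) ≤ ε}`. -/
noncomputable def pspecR {n : ℕ} (ε : ℝ) (E : Matrix (Fin (n + 2)) (Fin n) ℂ) :
    Set ℂ :=
  {z : ℂ | sval (E - z • IP n) ≤ ε}

/-- ε_n := 2 sin(π/(4n+2)). -/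
noncomputable def epsV (n : ℕ) : ℝ := 2 * Real.sin (Real.pi / (4 * (n : ℝ) + 2))

/-- ε'_n := 2 sin(π/(2n)). -/
noncomputable def epsV' (n : ℕ) : ℝ := 2 * Real.sin (Real.pi / (2 * (n : ℝ)))

/-- ε''_n := 2 sin(π/(2n+2)). -/
noncomputable def epsV'' (n : ℕ) : ℝ := 2 * Real.sin (Real.pi / (2 * (n : ℝ) + 2))

/-- The τ-method inclusion set `Σ^n_ε(V_N)` (independent of `N ≥ n+1`). -/
noncomputable def SigmaV (n : ℕ) (ε : ℝ) : Set ℂ :=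
  if n ≤ 2 then ⋃ m : Fin n, pspec (ε + epsV n) (Vm (m + 1))
  else pspec (ε + epsV (n - 2)) (Vm n) ∩ ⋃ m : Fin n, pspec (ε + epsV n) (Vm (m + 1))

/-- The π-method inclusion set `Π^{n,t}_ε(V_N)`. -/
noncomputable def PiV (n : ℕ) (t : ℂ) (ε : ℝ) : Set ℂ :=
  pspec (ε + epsV' n) (Vm n) ∪ pspec (ε + epsV' n) (Vper n t)

/-- The τ₁-method inclusion set `Γ^n_ε(V_N)`. -/
noncomputable def GammaV (n : ℕ) (ε : ℝ) : Set ℂ :=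
  pspecR (ε + epsV'' n) (VP n) ∪ pspecR (ε + epsV'' n) (VtP n)

/-- The closed disc of radius `r` centred at the origin. -/
def cDisc (r : ℝ) : Set ℂ := {z : ℂ | ‖z‖ ≤ r}

/-- The n×n discrete Laplacian `L_n` (zero diagonal, ones on the first sub-
and superdiagonals). -/
def Lm (n : ℕ) : Matrix (Fin n) (Fin n) ℂ :=
  fun i j => if (i : ℕ) + 1 = (j : ℕ) ∨ (j : ℕ) + 1 = (i : ℕ) then 1 else 0

/-- θ_n for the discrete Laplacian: the unique solution of
`8 sin(t/2) cos((n+1/2)t) + sin((n−1)t) = 0` in `[π/(2n+1), π/(n+2)]`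
(by uniqueness, the infimum of the solution set). -/
noncomputable def thetaL (n : ℕ) : ℝ :=
  sInf {t : ℝ | t ∈ Set.Icc (Real.pi / (2 * (n : ℝ) + 1)) (Real.pi / ((n : ℝ) + 2)) ∧
    8 * Real.sin (t / 2) * Real.cos (((n : ℝ) + 1 / 2) * t)
      + Real.sin (((n : ℝ) - 1) * t) = 0}

/-- ε_n := 4 sin(θ_n/2) for the discrete Laplacian. -/
noncomputable def epsL (n : ℕ) : ℝ := 4 * Real.sin (thetaL n / 2)

/-- ε''_n := 4 sin(π/(2n+2)) for the discrete Laplacian. -/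
noncomputable def epsL'' (n : ℕ) : ℝ := 4 * Real.sin (Real.pi / (2 * (n : ℝ) + 2))

/-- The τ-method inclusion set `Σ^n_ε(L_N)` (independent of `N ≥ n+1`). -/
noncomputable def SigmaL (n : ℕ) (ε : ℝ) : Set ℂ :=
  if n ≤ 2 then ⋃ m : Fin n, pspec (ε + epsL n) (Lm (m + 1))
  else pspec (ε + epsL (n - 2)) (Lm n) ∩ ⋃ m : Fin n, pspec (ε + epsL n) (Lm (m + 1))

/-- The (n+2)×n matrix `L⁺_n`: first row `(1,0,…,0)`, middle n rows `L_n`,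
last row `(0,…,0,1)`. -/
def LP (n : ℕ) : Matrix (Fin (n + 2)) (Fin n) ℂ :=
  fun i j => if ((i : ℕ) = 0 ∧ (j : ℕ) = 0) ∨
      (1 ≤ (i : ℕ) ∧ (i : ℕ) ≤ n ∧ ((j : ℤ) = (i : ℤ) - 2 ∨ (j : ℤ) = (i : ℤ))) ∨
      ((i : ℕ) = n + 1 ∧ (j : ℕ) + 1 = n) then 1 else 0

/-- The (n+2)×n matrix `L̃⁺_n`: first row `(1,0,…,0)`, middle n rows `L_n`,
last row zero. -/
def LtP (n : ℕ) : Matrix (Fin (n + 2)) (Fin n) ℂ :=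
  fun i j => if ((i : ℕ) = 0 ∧ (j : ℕ) = 0) ∨
      (1 ≤ (i : ℕ) ∧ (i : ℕ) ≤ n ∧ ((j : ℤ) = (i : ℤ) - 2 ∨ (j : ℤ) = (i : ℤ)))
    then 1 else 0

/-- The τ₁-method inclusion set `Γ^n_ε(L_N)`. -/
noncomputable def GammaL (N n : ℕ) (ε : ℝ) : Set ℂ :=
  if n = N - 1 then pspecR (ε + epsL'' n) (LtP n)
  else pspecR (ε + epsL'' n) (LP n) ∪ pspecR (ε + epsL'' n) (LtP n)

/-- The set `[−2,2] + ε·𝔻̄ ⊆ ℂ`. -/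
def bandSet (ε : ℝ) : Set ℂ :=
  {z : ℂ | ∃ x : ℝ, x ∈ Set.Icc (-2 : ℝ) 2 ∧ ‖z - (x : ℂ)‖ ≤ ε}

end SpecInclJL

namespace SpecInclJL

section SmallestSingularValue

variable {ι κ : Type*} [Fintype ι] [Fintype κ] [DecidableEq κ]

lemma sval_le_of_norm_le (F : Matrix ι κ ℂ) (x : EuclideanSpace ℂ κ) (hx : x ≠ 0) {c : ℝ}
    (h : ‖Matrix.toEuclideanLin F x‖ ≤ c * ‖x‖) : sval F ≤ c := by
  have hx0 : 0 < ‖x‖ := norm_pos_iff.mpr hx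
  have hbdd : BddBelow {y : ℝ | ∃ x : EuclideanSpace ℂ κ,
      ‖x‖ = 1 ∧ y = ‖Matrix.toEuclideanLin F x‖} :=
    ⟨0, by rintro y ⟨x, -, rfl⟩; exact norm_nonneg _⟩
  refine (csInf_le hbdd ⟨((‖x‖⁻¹ : ℝ) : ℂ) • x, ?_, rfl⟩).trans ?_
  · rw [norm_smul, Complex.norm_real, norm_inv, norm_norm, inv_mul_cancel₀ hx0.ne']
  · rw [map_smul, norm_smul, Complex.norm_real, norm_inv, norm_norm, inv_mul_le_iff₀ hx0, mul_comm]
    exact h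

lemma exists_norm_lt_of_sval_lt [Nonempty κ] (F : Matrix ι κ ℂ) {c : ℝ} (h : sval F < c) :
    ∃ x : EuclideanSpace ℂ κ, ‖x‖ = 1 ∧ ‖Matrix.toEuclideanLin F x‖ < c := by
  obtain ⟨x₀, hx₀⟩ := exists_norm_eq (EuclideanSpace ℂ κ) zero_le_one
  have hne : {y : ℝ | ∃ x : EuclideanSpace ℂ κ,
      ‖x‖ = 1 ∧ y = ‖Matrix.toEuclideanLin F x‖}.Nonempty := ⟨_, x₀, hx₀, rfl⟩
  obtain ⟨_, ⟨x, hx, rfl⟩, hy⟩ := exists_lt_of_csInf_lt hne h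
  exact ⟨x, hx, hy⟩

end SmallestSingularValue

lemma toEuclideanLin_sub_smul_one {n : ℕ} (A : Matrix (Fin n) (Fin n) ℂ) (z : ℂ)
    (x : EuclideanSpace ℂ (Fin n)) :
    Matrix.toEuclideanLin (A - z • (1 : Matrix (Fin n) (Fin n) ℂ)) x
      = Matrix.toEuclideanLin A x - z • x := by
  ext i
  simp

/-- The vector `(f 1, …, f n)`. -/
def sampleVec (n : ℕ) (f : ℕ → ℂ) : EuclideanSpace ℂ (Fin n) :=
  WithLp.toLp 2 fun j => f (j + 1)

lemma norm_sampleVec_sq (n : ℕ) (f : ℕ → ℂ) :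
    ‖sampleVec n f‖ ^ 2 = ∑ k ∈ Finset.range n, ‖f (k + 1)‖ ^ 2 := by
  rw [EuclideanSpace.norm_sq_eq, ← Fin.sum_univ_eq_sum_range (fun k => ‖f (k + 1)‖ ^ 2)]
  rfl

lemma exists_eq_sampleVec {n : ℕ} (x : EuclideanSpace ℂ (Fin n)) :
    ∃ f : ℕ → ℂ, f 0 = 0 ∧ f (n + 1) = 0 ∧ x = sampleVec n f := by
  refine ⟨fun k => if h : 1 ≤ k ∧ k - 1 < n then x ⟨k - 1, h.2⟩ else 0, by simp, by simp, ?_⟩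
  ext i
  simp [sampleVec]

lemma Lm_sampleVec {n : ℕ} {f : ℕ → ℂ} (h0 : f 0 = 0) (hn : f (n + 1) = 0) (i : Fin n) :
    (Matrix.toEuclideanLin (Lm n) (sampleVec n f)) i = f i + f (i + 2) := by
  have hsum : (Matrix.toEuclideanLin (Lm n) (sampleVec n f)) i
      = ∑ j : Fin n, ((if (j : ℕ) + 1 = i then f i else 0)
        + if (j : ℕ) = i + 1 then f (i + 2) else 0) := by
    simp only [Matrix.toLpLin_apply, Matrix.mulVec, dotProduct, sampleVec, Lm]
    refine Finset.sum_congr rfl fun j _ => ?_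
    by_cases h1 : (j : ℕ) + 1 = i
    · have h2 : ¬ (j : ℕ) = i + 1 := by omega
      simp [h1, h2]
    · by_cases h2 : (j : ℕ) = i + 1
      · rw [if_pos (Or.inl h2.symm), if_neg h1, if_pos h2, zero_add, one_mul, h2]
      · have h3 : ¬ ((i : ℕ) + 1 = j) := by omega
        simp [h1, h2, h3]
  rw [hsum, Fin.sum_univ_eq_sum_range (fun j => (if j + 1 = (i : ℕ) then f i else 0)
    + if j = (i : ℕ) + 1 then f (i + 2) else 0), Finset.sum_add_distrib]
  have hi := i.2
  congr 1
  · rcases hk : (i : ℕ) with _ | k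
    · simp [h0]
    · simp only [add_left_inj, Finset.sum_ite_eq', Finset.mem_range]
      rw [if_pos (by omega)]
  · rw [Finset.sum_ite_eq']
    split_ifs with h
    · rfl
    · rw [Finset.mem_range] at h
      have : (i : ℕ) + 2 = n + 1 := by omega
      rw [this, hn]

lemma norm_Lm_sub_sampleVec_sq {n : ℕ} {f : ℕ → ℂ} (h0 : f 0 = 0) (hn : f (n + 1) = 0) (z : ℂ) :
    ‖Matrix.toEuclideanLin (Lm n - z • (1 : Matrix (Fin n) (Fin n) ℂ)) (sampleVec n f)‖ ^ 2
      = ∑ k ∈ Finset.range n, ‖f k + f (k + 2) - z * f (k + 1)‖ ^ 2 := by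
  rw [EuclideanSpace.norm_sq_eq, toEuclideanLin_sub_smul_one,
    ← Fin.sum_univ_eq_sum_range (fun k => ‖f k + f (k + 2) - z * f (k + 1)‖ ^ 2)]
  refine Finset.sum_congr rfl fun i _ => ?_
  rw [PiLp.sub_apply, Lm_sampleVec h0 hn]
  rfl

lemma norm_Lm_apply_le {n : ℕ} (x : EuclideanSpace ℂ (Fin n)) :
    ‖Matrix.toEuclideanLin (Lm n) x‖ ≤ 2 * ‖x‖ := by
  obtain ⟨f, h0, hn, rfl⟩ := exists_eq_sampleVec x
  refine le_of_sq_le_sq ?_ (by positivity)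
  have h := norm_Lm_sub_sampleVec_sq h0 hn 0
  simp only [zero_smul, sub_zero, zero_mul] at h
  rw [h, mul_pow, norm_sampleVec_sq]
  have hpt : ∀ k, ‖f k + f (k + 2)‖ ^ 2 ≤ 2 * ‖f k‖ ^ 2 + 2 * ‖f (k + 2)‖ ^ 2 := fun k => by
    nlinarith [norm_add_le (f k) (f (k + 2)), norm_nonneg (f k + f (k + 2)),
      sq_nonneg (‖f k‖ - ‖f (k + 2)‖), norm_nonneg (f k), norm_nonneg (f (k + 2))]
  have hsum := Finset.sum_le_sum fun k (_ : k ∈ Finset.range n) => hpt k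
  rw [Finset.sum_add_distrib, ← Finset.mul_sum, ← Finset.mul_sum] at hsum
  have e1 := Finset.sum_range_succ (fun k => ‖f k‖ ^ 2) n
  rw [Finset.sum_range_succ'] at e1
  have e2 := Finset.sum_range_succ (fun k => ‖f (k + 1)‖ ^ 2) n
  rw [Finset.sum_range_succ'] at e2
  simp only [h0, hn, norm_zero] at e1 e2
  nlinarith [sq_nonneg ‖f n‖, sq_nonneg ‖f (0 + 1)‖]

lemma Lm_isHermitian (n : ℕ) : (Lm n).IsHermitian := by
  ext i j
  simp only [Matrix.conjTranspose_apply, Lm, or_comm]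
  split_ifs <;> simp

lemma mem_bandSet_of_norm_le {n : ℕ} {z : ℂ} {c : ℝ} {x : EuclideanSpace ℂ (Fin n)}
    (hx : ‖x‖ = 1)
    (h : ‖Matrix.toEuclideanLin (Lm n - z • (1 : Matrix (Fin n) (Fin n) ℂ)) x‖ ≤ c) :
    z ∈ bandSet c := by
  rw [toEuclideanLin_sub_smul_one] at h
  set T := Matrix.toEuclideanLin (Lm n) with hT
  have hsymm : T.IsSymmetric := Matrix.isSymmetric_toEuclideanLin_iff.mpr (Lm_isHermitian n)
  have hreal := hsymm.coe_re_inner_apply_self x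
  set r : ℝ := RCLike.re (inner ℂ (T x) x)
  have hr : |r| ≤ 2 := by
    have h1 := norm_inner_le_norm (𝕜 := ℂ) (T x) x
    have h2 := norm_Lm_apply_le x
    rw [← hreal, RCLike.norm_ofReal, hx, mul_one] at h1
    rw [hx, mul_one] at h2
    exact h1.trans h2
  refine ⟨r, abs_le.mp hr, ?_⟩
  have h1 := norm_inner_le_norm (𝕜 := ℂ) (T x - z • x) x
  rw [inner_sub_left, inner_smul_left, ← hreal, inner_self_eq_norm_sq_to_K, hx] at h1
  have h2 : ‖z - (r : ℂ)‖ = ‖(r : ℂ) - (starRingEnd ℂ) z‖ := by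
    rw [norm_sub_rev, ← Complex.norm_conj, map_sub, Complex.conj_ofReal]
  rw [h2]
  simp only [mul_one, RCLike.ofReal_one, one_pow] at h1
  exact h1.trans h

lemma pspec_mono {ι : Type*} [Fintype ι] [DecidableEq ι] {a b : ℝ} (h : a ≤ b)
    (E : Matrix ι ι ℂ) : pspec a E ⊆ pspec b E :=
  fun _ hz => le_trans hz h

lemma pspec_Lm_subset_bandSet {n : ℕ} (hn : 0 < n) {a b : ℝ} (hab : a < b) :
    pspec a (Lm n) ⊆ bandSet b := by
  intro z hz
  have : Nonempty (Fin n) := ⟨⟨0, hn⟩⟩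
  obtain ⟨x, hx, hxc⟩ := exists_norm_lt_of_sval_lt _ (lt_of_le_of_lt hz hab)
  exact mem_bandSet_of_norm_le hx hxc.le

lemma norm_toEuclideanLin_sq_of_middle {n : ℕ} (M : Matrix (Fin (n + 2)) (Fin n) ℂ)
    (A : Matrix (Fin n) (Fin n) ℂ) (h : ∀ i j, M i.castSucc.succ j = A i j)
    (x : EuclideanSpace ℂ (Fin n)) :
    ‖Matrix.toEuclideanLin M x‖ ^ 2 = ‖(Matrix.toEuclideanLin M x) 0‖ ^ 2
      + (‖Matrix.toEuclideanLin A x‖ ^ 2 + ‖(Matrix.toEuclideanLin M x) (Fin.last n).succ‖ ^ 2) := by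
  rw [EuclideanSpace.norm_sq_eq, Fin.sum_univ_succ, Fin.sum_univ_castSucc,
    EuclideanSpace.norm_sq_eq (Matrix.toEuclideanLin A x)]
  simp only [Matrix.toLpLin_apply, Matrix.mulVec, dotProduct, h]

lemma IP_middle {n : ℕ} (i j : Fin n) :
    IP n i.castSucc.succ j = (1 : Matrix (Fin n) (Fin n) ℂ) i j := by
  simp [IP, Matrix.one_apply, Fin.ext_iff]

lemma LP_middle {n : ℕ} (i j : Fin n) : LP n i.castSucc.succ j = Lm n i j := by
  have := i.2
  simp only [LP, Lm, Fin.val_succ, Fin.val_castSucc]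
  congr 1
  simp only [eq_iff_iff]
  omega

lemma LtP_middle {n : ℕ} (i j : Fin n) : LtP n i.castSucc.succ j = Lm n i j := by
  have := i.2
  simp only [LtP, Lm, Fin.val_succ, Fin.val_castSucc]
  congr 1
  simp only [eq_iff_iff]
  omega

lemma sub_smul_IP_middle {n : ℕ} {M : Matrix (Fin (n + 2)) (Fin n) ℂ}
    {A : Matrix (Fin n) (Fin n) ℂ} (h : ∀ i j, M i.castSucc.succ j = A i j) (z : ℂ) (i j : Fin n) :
    (M - z • IP n) i.castSucc.succ j = (A - z • (1 : Matrix (Fin n) (Fin n) ℂ)) i j := by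
  simp only [Matrix.sub_apply, Matrix.smul_apply, h, IP_middle]

lemma pspecR_subset_bandSet {n : ℕ} (hn : 0 < n) {M : Matrix (Fin (n + 2)) (Fin n) ℂ}
    (h : ∀ i j, M i.castSucc.succ j = Lm n i j) {a b : ℝ} (hab : a < b) :
    pspecR a M ⊆ bandSet b := by
  intro z hz
  have : Nonempty (Fin n) := ⟨⟨0, hn⟩⟩
  obtain ⟨x, hx, hxc⟩ := exists_norm_lt_of_sval_lt _ (lt_of_le_of_lt hz hab)
  refine mem_bandSet_of_norm_le hx (le_trans (le_of_sq_le_sq ?_ (norm_nonneg _)) hxc.le)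
  rw [norm_toEuclideanLin_sq_of_middle _ _ (sub_smul_IP_middle h z)]
  nlinarith [sq_nonneg ‖(Matrix.toEuclideanLin (M - z • IP n) x) 0‖,
    sq_nonneg ‖(Matrix.toEuclideanLin (M - z • IP n) x) (Fin.last n).succ‖]

lemma exists_mem_bandSet_dist_le {ε δ : ℝ} (hε : 0 ≤ ε) (hδ : 0 ≤ δ) {z : ℂ}
    (hz : z ∈ bandSet (ε + δ)) : ∃ w ∈ bandSet ε, dist z w ≤ δ := by
  obtain ⟨x, hx, hzx⟩ := hz
  rcases (add_nonneg hε hδ).eq_or_lt with h | h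
  · refine ⟨z, ⟨x, hx, ?_⟩, by simpa using hδ⟩
    linarith
  · have hne : ε + δ ≠ 0 := h.ne'
    refine ⟨x + ((ε / (ε + δ) : ℝ) : ℂ) * (z - x), ⟨x, hx, ?_⟩, ?_⟩
    · rw [add_sub_cancel_left, norm_mul, Complex.norm_real, Real.norm_of_nonneg (by positivity)]
      calc ε / (ε + δ) * ‖z - x‖ ≤ ε / (ε + δ) * (ε + δ) := by gcongr
        _ = ε := by field_simp
    · have : z - (x + ((ε / (ε + δ) : ℝ) : ℂ) * (z - x)) = ((δ / (ε + δ) : ℝ) : ℂ) * (z - x) := by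
        have : (δ / (ε + δ) : ℝ) = 1 - ε / (ε + δ) := by field_simp; ring
        rw [this]; push_cast; ring
      rw [dist_eq_norm, this, norm_mul, Complex.norm_real, Real.norm_of_nonneg (by positivity)]
      calc δ / (ε + δ) * ‖z - x‖ ≤ δ / (ε + δ) * (ε + δ) := by gcongr
        _ = δ := by field_simp

lemma mem_pspec_of_norm_sub_eigenvalue_le {n k : ℕ} (hk : 1 ≤ k) (hkn : k ≤ n) {ε : ℝ} {z : ℂ}
    (hz : ‖z - ((2 * Real.cos (k * π / (n + 1)) : ℝ) : ℂ)‖ ≤ ε) : z ∈ pspec ε (Lm n) := by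
  set θ : ℝ := k * π / (n + 1) with hθ
  have hn1 : (0 : ℝ) < n + 1 := by positivity
  set f : ℕ → ℂ := fun j => (Real.sin (j * θ) : ℂ) with hf
  have h0 : f 0 = 0 := by simp [hf]
  have hN : f (n + 1) = 0 := by
    have : ((n + 1 : ℕ) : ℝ) * θ = k * π := by rw [hθ]; push_cast; field_simp
    simp only [hf, this, Real.sin_nat_mul_pi, Complex.ofReal_zero]
  have hrec : ∀ j, f j + f (j + 2) = (2 * Real.cos θ : ℝ) * f (j + 1) := fun j => by
    have e1 : ((j : ℕ) : ℝ) * θ = ((j + 1 : ℕ) : ℝ) * θ - θ := by push_cast; ring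
    have e2 : ((j + 2 : ℕ) : ℝ) * θ = ((j + 1 : ℕ) : ℝ) * θ + θ := by push_cast; ring
    simp only [hf]
    rw [e1, e2, Real.sin_sub, Real.sin_add]
    push_cast; ring
  have hsin : 0 < Real.sin θ := by
    apply Real.sin_pos_of_pos_of_lt_pi
    · have : (1 : ℝ) ≤ k := by exact_mod_cast hk
      rw [hθ]; positivity
    · rw [hθ, div_lt_iff₀ hn1, mul_comm]
      have : (k : ℝ) ≤ n := by exact_mod_cast hkn
      exact mul_lt_mul_of_pos_left (by linarith) Real.pi_pos
  refine sval_le_of_norm_le _ (sampleVec n f) ?_ ?_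
  · intro h
    have := congrArg (fun v : EuclideanSpace ℂ (Fin n) => v ⟨0, by omega⟩) h
    simp only [sampleVec, hf, PiLp.zero_apply] at this
    norm_num at this
    exact hsin.ne' (by exact_mod_cast this)
  · refine le_of_sq_le_sq ?_ (mul_nonneg ((norm_nonneg _).trans hz) (norm_nonneg _))
    rw [norm_Lm_sub_sampleVec_sq h0 hN, mul_pow, norm_sampleVec_sq, Finset.mul_sum]
    refine Finset.sum_le_sum fun j _ => ?_
    rw [hrec, ← sub_mul, norm_mul, mul_pow, norm_sub_rev]
    gcongr

lemma exists_angle_near {n : ℕ} (hn : 1 ≤ n) {φ : ℝ} (h0 : 0 ≤ φ) (hπ : φ ≤ π) :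
    ∃ k : ℕ, 1 ≤ k ∧ k ≤ n ∧ |φ - k * π / (n + 1)| ≤ π / (n + 1) := by
  have hn1 : (0 : ℝ) < n + 1 := by positivity
  have hn' : (1 : ℝ) ≤ n := by exact_mod_cast hn
  have key : ∀ k : ℕ, |φ * (n + 1) / π - k| ≤ 1 → |φ - k * π / (n + 1)| ≤ π / (n + 1) := by
    intro k hk
    have : φ - k * π / (n + 1) = (φ * (n + 1) / π - k) * (π / (n + 1)) := by
      field_simp
    rw [this, abs_mul, abs_of_pos (a := π / (n + 1)) (by positivity)]
    exact mul_le_of_le_one_left (by positivity) hk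
  set y := φ * (n + 1) / π
  have hy0 : 0 ≤ y := by positivity
  have hyn : y ≤ n + 1 := by
    rw [div_le_iff₀ Real.pi_pos, mul_comm]; gcongr
  by_cases h1 : y < 1
  · exact ⟨1, le_rfl, hn, key 1 (abs_le.mpr ⟨by push_cast; linarith, by push_cast; linarith⟩)⟩
  by_cases h2 : y < n
  · refine ⟨⌊y⌋₊, Nat.one_le_floor_iff y |>.mpr (not_lt.mp h1), ?_, key _ ?_⟩
    · exact Nat.floor_le_of_le h2.le
    · have := Nat.floor_le hy0
      have := Nat.lt_floor_add_one y
      exact abs_le.mpr ⟨by linarith, by linarith⟩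
  · exact ⟨n, hn, le_rfl, key n (abs_le.mpr ⟨by linarith, by linarith⟩)⟩

lemma exists_eq_two_mul_cos {x : ℝ} (hx : x ∈ Set.Icc (-2 : ℝ) 2) :
    ∃ φ, 0 ≤ φ ∧ φ ≤ π ∧ x = 2 * Real.cos φ :=
  ⟨Real.arccos (x / 2), Real.arccos_nonneg _, Real.arccos_le_pi _, by
    rw [Real.cos_arccos (by linarith [hx.1]) (by linarith [hx.2])]; ring⟩

lemma exists_mem_pspec_Lm_dist_le {n : ℕ} (hn : 1 ≤ n) {ε : ℝ} {z : ℂ} (hz : z ∈ bandSet ε) :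
    ∃ w ∈ pspec ε (Lm n), dist z w ≤ 2 * (π / (n + 1)) := by
  obtain ⟨x, hx, hzx⟩ := hz
  obtain ⟨φ, h0, hπ, rfl⟩ := exists_eq_two_mul_cos hx
  obtain ⟨k, hk, hkn, hd⟩ := exists_angle_near hn h0 hπ
  refine ⟨z - ((2 * Real.cos φ : ℝ) : ℂ) + ((2 * Real.cos (k * π / (n + 1)) : ℝ) : ℂ),
    mem_pspec_of_norm_sub_eigenvalue_le hk hkn (by rwa [add_sub_cancel_right]), ?_⟩
  have : z - (z - ((2 * Real.cos φ : ℝ) : ℂ) + ((2 * Real.cos (k * π / (n + 1)) : ℝ) : ℂ))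
      = ((2 * (Real.cos φ - Real.cos (k * π / (n + 1))) : ℝ) : ℂ) := by push_cast; ring
  rw [dist_eq_norm, this, Complex.norm_real, Real.norm_eq_abs, abs_mul, abs_two]
  gcongr
  exact (Real.abs_cos_sub_cos_le _ _).trans hd

lemma sum_sin_sq_eq_sum_cos_sq_add_one {n : ℕ} (hn : 1 ≤ n) {α : ℝ} (hα : α = π / (n + 1)) :
    ∑ k ∈ Finset.range n, Real.sin ((k + 1) * α) ^ 2
      = ∑ k ∈ Finset.range n, Real.cos ((k + 1) * α) ^ 2 + 1 := by
  have hn' : (1 : ℝ) ≤ n := by exact_mod_cast hn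
  have hα0 : 0 < α := by rw [hα]; positivity
  have hsin : 0 < Real.sin α := by
    refine Real.sin_pos_of_pos_of_lt_pi hα0 ?_
    rw [hα]
    exact div_lt_self Real.pi_pos (by linarith)
  have htel := Finset.sum_range_sub (fun k : ℕ => Real.sin ((2 * k + 1) * α)) n
  have hlast : Real.sin ((2 * n + 1) * α) = - Real.sin α := by
    have : (2 * n + 1) * α = 2 * π - α := by rw [hα]; field_simp; ring
    rw [this, Real.sin_two_pi_sub]
  have hterm : ∀ k : ℕ, Real.sin ((2 * ((k + 1 : ℕ) : ℝ) + 1) * α) - Real.sin ((2 * (k : ℝ) + 1) * α)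
      = 2 * Real.sin α * (Real.cos ((k + 1) * α) ^ 2 - Real.sin ((k + 1) * α) ^ 2) := fun k => by
    have e1 : (2 * ((k + 1 : ℕ) : ℝ) + 1) * α = 2 * ((k + 1) * α) + α := by push_cast; ring
    have e2 : (2 * (k : ℝ) + 1) * α = 2 * ((k + 1) * α) - α := by ring
    rw [e1, e2, Real.sin_add, Real.sin_sub, Real.cos_two_mul']
    ring
  simp only [hterm, hlast] at htel
  rw [← Finset.mul_sum, Finset.sum_sub_distrib] at htel
  simp only [Nat.cast_zero, mul_zero, zero_add, one_mul] at htel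
  have := mul_left_cancel₀ (mul_pos two_pos hsin).ne'
    (htel.trans (by ring : _ = 2 * Real.sin α * (-1)))
  linarith

/-- The modulated sine sequence `j ↦ sin (j α) e^{i j φ}`. -/
def modulatedSine (α φ : ℝ) (j : ℕ) : ℂ :=
  Real.sin (j * α) * Complex.exp (((j * φ : ℝ) : ℂ) * Complex.I)

lemma norm_modulatedSine_sq (α φ : ℝ) (j : ℕ) :
    ‖modulatedSine α φ j‖ ^ 2 = Real.sin (j * α) ^ 2 := by
  rw [modulatedSine, norm_mul, Complex.norm_exp_ofReal_mul_I, mul_one, Complex.norm_real,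
    Real.norm_eq_abs, sq_abs]

lemma norm_modulatedSine_residual_sq (α φ : ℝ) (k : ℕ) :
    ‖modulatedSine α φ k + modulatedSine α φ (k + 2)
        - ((2 * Real.cos φ : ℝ) : ℂ) * modulatedSine α φ (k + 1)‖ ^ 2
      = 4 * Real.cos φ ^ 2 * (1 - Real.cos α) ^ 2 * Real.sin ((k + 1) * α) ^ 2
        + 4 * Real.sin φ ^ 2 * Real.sin α ^ 2 * Real.cos ((k + 1) * α) ^ 2 := by
  have hfac : modulatedSine α φ k + modulatedSine α φ (k + 2)
        - ((2 * Real.cos φ : ℝ) : ℂ) * modulatedSine α φ (k + 1)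
      = Complex.exp ((((k + 1) * φ : ℝ) : ℂ) * Complex.I)
        * (((2 * Real.cos φ * (Real.cos α - 1) * Real.sin ((k + 1) * α) : ℝ) : ℂ)
          + ((2 * Real.sin φ * Real.sin α * Real.cos ((k + 1) * α) : ℝ) : ℂ) * Complex.I) := by
    have e1 : (((k : ℝ) * φ : ℝ) : ℂ) * Complex.I
        = (((k + 1) * φ : ℝ) : ℂ) * Complex.I + (((-φ) : ℝ) : ℂ) * Complex.I := by
      push_cast; ring
    have e2 : ((((k + 2 : ℕ) : ℝ) * φ : ℝ) : ℂ) * Complex.I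
        = (((k + 1) * φ : ℝ) : ℂ) * Complex.I + (φ : ℂ) * Complex.I := by
      push_cast; ring
    have e3 : ((k + 1 : ℕ) : ℝ) = (k : ℝ) + 1 := by push_cast; ring
    have e4 : (k : ℝ) * α = (k + 1) * α - α := by ring
    have e5 : ((k + 2 : ℕ) : ℝ) * α = (k + 1) * α + α := by push_cast; ring
    simp only [modulatedSine]
    rw [e1, e2, e3, e4, e5, Complex.exp_add, Complex.exp_add, Real.sin_sub, Real.sin_add,
      Complex.exp_mul_I φ,
      Complex.exp_mul_I ((-φ : ℝ) : ℂ), ← Complex.ofReal_cos, ← Complex.ofReal_sin,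
      ← Complex.ofReal_cos, ← Complex.ofReal_sin, Real.cos_neg, Real.sin_neg]
    push_cast
    ring
  rw [hfac, norm_mul, Complex.norm_exp_ofReal_mul_I, one_mul, ← Complex.normSq_eq_norm_sq,
    Complex.normSq_add_mul_I]
  ring

lemma LtP_sub_apply_zero {n : ℕ} (hn : 1 ≤ n) (f : ℕ → ℂ) (z : ℂ) :
    (Matrix.toEuclideanLin (LtP n - z • IP n) (sampleVec n f)) 0 = f 1 := by
  obtain ⟨m, rfl⟩ := Nat.exists_eq_add_of_le' hn
  simp [Matrix.toLpLin_apply, Matrix.mulVec, dotProduct, sampleVec, LtP, IP]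

lemma LtP_sub_apply_last {n : ℕ} (x : EuclideanSpace ℂ (Fin n)) (z : ℂ) :
    (Matrix.toEuclideanLin (LtP n - z • IP n) x) (Fin.last n).succ = 0 := by
  simp only [Matrix.toLpLin_apply, Matrix.mulVec, dotProduct]
  refine Finset.sum_eq_zero fun j _ => ?_
  have hj := j.2
  simp [LtP, IP]
  omega

lemma norm_IP_apply {n : ℕ} (x : EuclideanSpace ℂ (Fin n)) :
    ‖Matrix.toEuclideanLin (IP n) x‖ = ‖x‖ := by
  refine (sq_eq_sq₀ (norm_nonneg _) (norm_nonneg _)).mp ?_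
  have h0 : (Matrix.toEuclideanLin (IP n) x) 0 = 0 := by
    simp [Matrix.toLpLin_apply, Matrix.mulVec, dotProduct, IP]
  have h1 : (Matrix.toEuclideanLin (IP n) x) (Fin.last n).succ = 0 := by
    simp only [Matrix.toLpLin_apply, Matrix.mulVec, dotProduct]
    refine Finset.sum_eq_zero fun j _ => ?_
    have hj : ¬ (n = (j : ℕ)) := j.2.ne'
    simp [IP, hj]
  rw [norm_toEuclideanLin_sq_of_middle _ _ IP_middle, h0, h1]
  simp

lemma norm_LtP_sub_modulatedSine_le {n : ℕ} (hn : 1 ≤ n) (φ : ℝ) :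
    ‖Matrix.toEuclideanLin (LtP n - ((2 * Real.cos φ : ℝ) : ℂ) • IP n)
        (sampleVec n (modulatedSine (π / (n + 1)) φ))‖
      ≤ epsL'' n * ‖sampleVec n (modulatedSine (π / (n + 1)) φ)‖ := by
  obtain ⟨α, hα⟩ : ∃ α : ℝ, α = π / (n + 1) := ⟨_, rfl⟩
  have hα2 : π / (2 * n + 2) = α / 2 := by rw [hα]; field_simp
  have hn' : (1 : ℝ) ≤ n := by exact_mod_cast hn
  have hα0 : 0 < α := by rw [hα]; positivity
  have hαπ : α ≤ π := by rw [hα]; exact div_le_self Real.pi_pos.le (by linarith)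
  have hs0 : 0 ≤ Real.sin (α / 2) :=
    Real.sin_nonneg_of_nonneg_of_le_pi (by linarith) (by linarith)
  have heps : epsL'' n = 4 * Real.sin (α / 2) := by rw [epsL'', hα2]
  have h0 : modulatedSine α φ 0 = 0 := by simp [modulatedSine]
  have hN : modulatedSine α φ (n + 1) = 0 := by
    have : ((n + 1 : ℕ) : ℝ) * α = π := by rw [hα]; push_cast; field_simp
    rw [modulatedSine, this, Real.sin_pi, Complex.ofReal_zero, zero_mul]
  rw [← hα, heps]
  refine le_of_sq_le_sq ?_ (by positivity)
  rw [norm_toEuclideanLin_sq_of_middle _ _ (sub_smul_IP_middle LtP_middle _), LtP_sub_apply_last,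
    LtP_sub_apply_zero hn, norm_modulatedSine_sq, norm_Lm_sub_sampleVec_sq h0 hN, mul_pow,
    norm_sampleVec_sq]
  simp only [norm_modulatedSine_residual_sq, norm_modulatedSine_sq, Finset.sum_add_distrib,
    ← Finset.mul_sum, Nat.cast_add, Nat.cast_one]
  rw [sum_sin_sq_eq_sum_cos_sq_add_one hn hα]
  have hC : 0 ≤ ∑ k ∈ Finset.range n, Real.cos ((k + 1) * α) ^ 2 :=
    Finset.sum_nonneg fun _ _ => sq_nonneg _
  generalize ∑ k ∈ Finset.range n, Real.cos ((k + 1) * α) ^ 2 = C at hC ⊢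
  have hc : 1 - Real.cos α = 2 * Real.sin (α / 2) ^ 2 := by
    have := Real.cos_sq' (α / 2)
    have h2 := Real.cos_two_mul (α / 2)
    rw [mul_div_cancel₀ _ (two_ne_zero' ℝ)] at h2
    rw [h2, this]; ring
  have hs : Real.sin α ^ 2 = 4 * Real.sin (α / 2) ^ 2 * (1 - Real.sin (α / 2) ^ 2) := by
    have h2 := Real.sin_two_mul (α / 2)
    rw [mul_div_cancel₀ _ (two_ne_zero' ℝ)] at h2
    rw [h2, ← Real.cos_sq']; ring
  have hS1 : Real.sin (α / 2) ^ 2 ≤ 1 := Real.sin_sq_le_one _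
  have hS0 := sq_nonneg (Real.sin (α / 2))
  rw [hc, Real.cos_sq' φ, norm_zero]
  simp only [one_mul, hs, mul_pow]
  have hp1 : Real.sin φ ^ 2 ≤ 1 := Real.sin_sq_le_one _
  have hp0 := sq_nonneg (Real.sin φ)
  generalize Real.sin (α / 2) ^ 2 = S at *
  generalize Real.sin φ ^ 2 = p at *
  have hmain : (1 - S) + 4 * p * (1 - S) * C + 4 * S * (1 - p) * (C + 1) ≤ 4 * (C + 1) := by
    have a1 : 0 ≤ C * (p * S + (1 - p) * (1 - S)) :=
      mul_nonneg hC (add_nonneg (mul_nonneg hp0 hS0) (mul_nonneg (by linarith) (by linarith)))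
    have a2 : 0 ≤ S * p := mul_nonneg hS0 hp0
    nlinarith
  nlinarith [mul_le_mul_of_nonneg_left hmain hS0]

lemma bandSet_subset_pspecR_LtP {n : ℕ} (hn : 1 ≤ n) (ε : ℝ) :
    bandSet ε ⊆ pspecR (ε + epsL'' n) (LtP n) := by
  rintro z ⟨x, hx, hzx⟩
  obtain ⟨φ, -, -, rfl⟩ := exists_eq_two_mul_cos hx
  set v := sampleVec n (modulatedSine (π / (n + 1)) φ) with hv
  refine sval_le_of_norm_le _ v ?_ ?_
  · intro h
    have hpos : 0 < ‖v‖ ^ 2 := by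
      rw [hv, norm_sampleVec_sq]
      simp only [norm_modulatedSine_sq, Nat.cast_add, Nat.cast_one]
      rw [sum_sin_sq_eq_sum_cos_sq_add_one hn rfl]
      exact add_pos_of_nonneg_of_pos (Finset.sum_nonneg fun _ _ => sq_nonneg _) one_pos
    simp [h] at hpos
  · have hsplit : LtP n - z • IP n = (LtP n - ((2 * Real.cos φ : ℝ) : ℂ) • IP n)
        - (z - ((2 * Real.cos φ : ℝ) : ℂ)) • IP n := by
      rw [sub_smul]; abel
    rw [hsplit, map_sub, LinearMap.sub_apply, map_smul, LinearMap.smul_apply, add_mul,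
      add_comm (ε * ‖v‖)]
    refine (norm_sub_le _ _).trans (add_le_add (norm_LtP_sub_modulatedSine_le hn φ) ?_)
    rw [norm_smul, norm_IP_apply]
    gcongr

lemma thetaL_mem (n : ℕ) : 0 ≤ thetaL n ∧ thetaL n ≤ π / (n + 2) := by
  unfold thetaL
  set T := {t : ℝ | t ∈ Set.Icc (Real.pi / (2 * (n : ℝ) + 1)) (Real.pi / ((n : ℝ) + 2)) ∧
    8 * Real.sin (t / 2) * Real.cos (((n : ℝ) + 1 / 2) * t) + Real.sin (((n : ℝ) - 1) * t) = 0}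
  have hT : ∀ t ∈ T, 0 ≤ t := fun t ht => le_trans (by positivity) ht.1.1
  refine ⟨Real.sInf_nonneg hT, ?_⟩
  rcases T.eq_empty_or_nonempty with h | ⟨t, ht⟩
  · rw [h, Real.sInf_empty]; positivity
  · exact (csInf_le ⟨0, hT⟩ ht).trans ht.1.2

lemma epsL_nonneg (n : ℕ) : 0 ≤ epsL n := by
  obtain ⟨h0, h1⟩ := thetaL_mem n
  have : π / (n + 2) ≤ π := div_le_self Real.pi_pos.le (by linarith [n.cast_nonneg (α := ℝ)])
  exact mul_nonneg (by norm_num)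
    (Real.sin_nonneg_of_nonneg_of_le_pi (by linarith) (by linarith))

lemma epsL_le (n : ℕ) : epsL n ≤ 2 * (π / (n + 2)) := by
  obtain ⟨h0, h1⟩ := thetaL_mem n
  have := Real.sin_le (x := thetaL n / 2) (by linarith)
  rw [epsL]
  linarith

lemma epsL''_le (n : ℕ) : epsL'' n ≤ 2 * (π / (n + 1)) := by
  have := Real.sin_le (x := π / (2 * n + 2)) (by positivity)
  have h : π / (2 * (n : ℝ) + 2) = π / (n + 1) / 2 := by field_simp
  rw [epsL'', h]
  rw [h] at this
  linarith

/-- Each of two sets lies in the closed `δ`-neighbourhood of the other, with distances attained. -/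
def Near (δ : ℝ) (S T : Set ℂ) : Prop :=
  (∀ x ∈ S, ∃ y ∈ T, dist x y ≤ δ) ∧ ∀ y ∈ T, ∃ x ∈ S, dist y x ≤ δ

lemma Near.symm {δ : ℝ} {S T : Set ℂ} (h : Near δ S T) : Near δ T S := ⟨h.2, h.1⟩

lemma Near.trans {δ η : ℝ} {S T U : Set ℂ} (h : Near δ S T) (h' : Near η T U) :
    Near (δ + η) S U := by
  constructor
  · intro x hx
    obtain ⟨y, hy, hxy⟩ := h.1 x hx
    obtain ⟨z, hz, hyz⟩ := h'.1 y hy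
    exact ⟨z, hz, (dist_triangle x y z).trans (add_le_add hxy hyz)⟩
  · intro z hz
    obtain ⟨y, hy, hzy⟩ := h'.2 z hz
    obtain ⟨x, hx, hyx⟩ := h.2 y hy
    exact ⟨x, hx, (dist_triangle z y x).trans (by linarith)⟩

lemma Near.hausdorffDist_le {δ : ℝ} (hδ : 0 ≤ δ) {S T : Set ℂ} (h : Near δ S T) :
    Metric.hausdorffDist S T ≤ δ :=
  Metric.hausdorffDist_le_of_mem_dist hδ h.1 h.2

lemma near_pspec_bandSet {ε δ : ℝ} (hε : 0 ≤ ε) (hδ : 0 < δ) {n : ℕ} (hn : 1 ≤ n)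
    (h : 2 * (π / (n + 1)) ≤ δ) : Near δ (pspec ε (Lm n)) (bandSet ε) := by
  constructor
  · intro z hz
    exact exists_mem_bandSet_dist_le hε hδ.le
      (pspec_Lm_subset_bandSet hn (lt_add_of_pos_right ε hδ) hz)
  · intro z hz
    obtain ⟨w, hw, hzw⟩ := exists_mem_pspec_Lm_dist_le hn hz
    exact ⟨w, hw, hzw.trans h⟩

lemma near_SigmaL_bandSet {ε δ : ℝ} (hε : 0 ≤ ε) (hδ : 0 < δ) {n : ℕ} (hn : 3 ≤ n)
    (h : 2 * (π / (n + 1)) ≤ δ) (h' : 2 * (π / (n + 2)) < δ) :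
    Near δ (SigmaL n ε) (bandSet ε) := by
  rw [SigmaL, if_neg (by omega)]
  constructor
  · rintro z ⟨-, hz⟩
    obtain ⟨m, hm⟩ := Set.mem_iUnion.mp hz
    refine exists_mem_bandSet_dist_le hε hδ.le
      (pspec_Lm_subset_bandSet (Nat.succ_pos _) ?_ hm)
    linarith [epsL_le n]
  · intro z hz
    obtain ⟨w, hw, hzw⟩ := exists_mem_pspec_Lm_dist_le (by omega : 1 ≤ n) hz
    refine ⟨w, ⟨pspec_mono (le_add_of_nonneg_right (epsL_nonneg _)) _ hw, ?_⟩, hzw.trans h⟩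
    refine Set.mem_iUnion.mpr ⟨⟨n - 1, by omega⟩, ?_⟩
    have hnn : n - 1 + 1 = n := by omega
    have hw' : w ∈ pspec ε (Lm (n - 1 + 1)) := by rwa [hnn]
    exact pspec_mono (le_add_of_nonneg_right (epsL_nonneg _)) _ hw'

lemma near_GammaL_bandSet {ε δ : ℝ} (hε : 0 ≤ ε) (hδ : 0 < δ) {n : ℕ} (N : ℕ) (hn : 1 ≤ n)
    (h : 2 * (π / (n + 1)) < δ) : Near δ (GammaL N n ε) (bandSet ε) := by
  have hlt : ε + epsL'' n < ε + δ := by linarith [epsL''_le n]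
  have hLt := pspecR_subset_bandSet hn LtP_middle hlt
  have hL := pspecR_subset_bandSet hn LP_middle hlt
  have hsub := bandSet_subset_pspecR_LtP hn ε
  rw [GammaL]
  constructor
  · intro z hz
    refine exists_mem_bandSet_dist_le hε hδ.le ?_
    split_ifs at hz
    · exact hLt hz
    · exact hz.elim (fun h => hL h) fun h => hLt h
  · intro z hz
    refine ⟨z, ?_, by simpa using hδ.le⟩
    split_ifs
    · exact hsub hz
    · exact Or.inr (hsub hz)

lemma exists_forall_two_mul_pi_div_lt {δ : ℝ} (hδ : 0 < δ) :
    ∃ n₀ : ℕ, 3 ≤ n₀ ∧ ∀ n : ℕ, n₀ ≤ n → 2 * (π / (n + 1)) < δ := by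
  obtain ⟨m, hm⟩ := exists_nat_gt (2 * π / δ)
  refine ⟨max 3 m, le_max_left _ _, fun n hn => ?_⟩
  have hmn : (m : ℝ) ≤ n := by exact_mod_cast (le_max_right 3 m).trans hn
  rw [← mul_div_assoc, div_lt_iff₀ (by positivity)]
  rw [div_lt_iff₀ hδ] at hm
  nlinarith

end SpecInclJL

open SpecInclJL in
/-- **Lemma 5.3 (convergence of the inclusion sets for the discrete
Laplacian).** For ε ≥ 0: `Spec_ε L_N → [−2,2]+ε𝔻̄` in Hausdorff distance as
`N → ∞`; each of `Σ^n_ε(L_N)` and `Γ^n_ε(L_N)` converges to `[−2,2]+ε𝔻̄` as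
`n, N → ∞` with `n < N`; and consequently each converges to `Spec_ε L_N` in
Hausdorff distance as `n, N → ∞` with `n < N`. -/
theorem laplacian_inclusion_sets_convergence (ε : ℝ) (hε : 0 ≤ ε) :
    Filter.Tendsto
      (fun N : ℕ => Metric.hausdorffDist (pspec ε (Lm N)) (bandSet ε))
      Filter.atTop (nhds 0) ∧
    (∀ δ : ℝ, 0 < δ → ∃ n₀ : ℕ, ∀ n N : ℕ, n₀ ≤ n → n < N →
      Metric.hausdorffDist (SigmaL n ε) (bandSet ε) ≤ δ ∧
      Metric.hausdorffDist (SigmaL n ε) (pspec ε (Lm N)) ≤ δ) ∧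
    (∀ δ : ℝ, 0 < δ → ∃ n₀ : ℕ, ∀ n N : ℕ, n₀ ≤ n → n < N →
      Metric.hausdorffDist (GammaL N n ε) (bandSet ε) ≤ δ ∧
      Metric.hausdorffDist (GammaL N n ε) (pspec ε (Lm N)) ≤ δ) := by
  refine ⟨?_, ?_, ?_⟩
  · rw [Metric.tendsto_atTop]
    intro δ hδ
    obtain ⟨n₀, hn₀, h⟩ := exists_forall_two_mul_pi_div_lt (half_pos hδ)
    refine ⟨n₀, fun N hN => ?_⟩
    have hd := (near_pspec_bandSet hε (half_pos hδ) (by omega : 1 ≤ N)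
      (h N hN).le).hausdorffDist_le (half_pos hδ).le
    rw [Real.dist_eq, sub_zero, abs_of_nonneg Metric.hausdorffDist_nonneg]
    linarith
  · intro δ hδ
    obtain ⟨n₀, hn₀, h⟩ := exists_forall_two_mul_pi_div_lt (half_pos hδ)
    refine ⟨n₀, fun n N hn hN => ?_⟩
    have hlt : 2 * (π / ((n : ℝ) + 2)) < δ / 2 := by
      refine lt_of_le_of_lt ?_ (h n hn)
      gcongr
      norm_num
    have hS := near_SigmaL_bandSet hε (half_pos hδ) (by omega : 3 ≤ n) (h n hn).le hlt
    have hP := near_pspec_bandSet hε (half_pos hδ) (by omega : 1 ≤ N) (h N (by omega)).le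
    refine ⟨(hS.hausdorffDist_le (half_pos hδ).le).trans (half_le_self hδ.le), ?_⟩
    simpa using (hS.trans hP.symm).hausdorffDist_le (by linarith)
  · intro δ hδ
    obtain ⟨n₀, hn₀, h⟩ := exists_forall_two_mul_pi_div_lt (half_pos hδ)
    refine ⟨n₀, fun n N hn hN => ?_⟩
    have hG := near_GammaL_bandSet hε (half_pos hδ) N (by omega : 1 ≤ n) (h n hn)
    have hP := near_pspec_bandSet hε (half_pos hδ) (by omega : 1 ≤ N) (h N (by omega)).le
    refine ⟨(hG.hausdorffDist_le (half_pos hδ).le).trans (half_le_self hδ.le), ?_⟩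
    simpa using (hG.trans hP.symm).hausdorffDist_le (by linarith)
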